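/- Let D be a Hamiltonian-path digraph on {1, …, m} with exactly k arcs. Then D has at least k + 1 source-to-sink paths, i.e., at least k + 1 directed paths from 1 to m. -/

import Mathlib

/-- A finite directed multigraph with vertex set `Fin m` and edge set `Fin q`,
given by source and target maps. -/
structure Multigraph (m q : ℕ) where
  src : Fin q → Fin m
  tgt : Fin q → Fin m

namespace Multigraph

variable {m q : ℕ}

/-- `p` is a directed path from `u` to `v`: a nonempty list of edges whose first edge
starts at `u`, whose last edge ends at `v`, and where consecutive edges are composable. -/
def IsPath (D : Multigraph m q) (u v : Fin m) (p : List (Fin q)) : Prop :=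
  (∃ e rest, p = e :: rest ∧ D.src e = u) ∧
  (∃ e rest, p = rest ++ [e] ∧ D.tgt e = v) ∧
  p.Chain' (fun a b => D.tgt a = D.src b)

/-- The number of directed paths from `u` to `v` (paths counted as edge sequences). -/
noncomputable def pathCount (D : Multigraph m q) (u v : Fin m) : ℕ :=
  Nat.card {p : List (Fin q) // D.IsPath u v p}

/-- `D` is acyclic: no vertex has a directed path to itself. -/
def Acyclic (D : Multigraph m q) : Prop :=
  ∀ v : Fin m, ¬ ∃ p, D.IsPath v v p

/-- In-degree of a vertex. -/
def indeg (D : Multigraph m q) (v : Fin m) : ℕ :=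
  (Finset.univ.filter (fun e => D.tgt e = v)).card

/-- Out-degree of a vertex. -/
def outdeg (D : Multigraph m q) (v : Fin m) : ℕ :=
  (Finset.univ.filter (fun e => D.src e = v)).card

/-- `D` is 3-regular: every vertex has total degree 3. -/
def ThreeRegular (D : Multigraph m q) : Prop :=
  ∀ v : Fin m, D.indeg v + D.outdeg v = 3

/-- `s` is the unique source (vertex of in-degree 0) of `D`. -/
def UniqueSource (D : Multigraph m q) (s : Fin m) : Prop :=
  D.indeg s = 0 ∧ ∀ v : Fin m, D.indeg v = 0 → v = s

/-- `t` is the unique sink (vertex of out-degree 0) of `D`. -/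
def UniqueSink (D : Multigraph m q) (t : Fin m) : Prop :=
  D.outdeg t = 0 ∧ ∀ v : Fin m, D.outdeg v = 0 → v = t

/-- `μ_D(v)`: the number of directed paths from `s` to `v`, with `μ_D(s) = 1`. -/
noncomputable def mu (D : Multigraph m q) (s v : Fin m) : ℕ :=
  if v = s then 1 else D.pathCount s v

/-- Two vertices are adjacent (disregarding orientation) via an edge in `S`. -/
def Adj (D : Multigraph m q) (S : Set (Fin q)) (a b : Fin m) : Prop :=
  ∃ e ∈ S, (D.src e = a ∧ D.tgt e = b) ∨ (D.src e = b ∧ D.tgt e = a)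

/-- Weak connectivity using only the edges in `S`: any two distinct vertices are joined
by a finite sequence of edges of `S` traversed in either direction. -/
def WeaklyConnectedOn (D : Multigraph m q) (S : Set (Fin q)) : Prop :=
  ∀ a b : Fin m, a ≠ b → Relation.ReflTransGen (D.Adj S) a b

/-- `D` is weakly connected. -/
def WeaklyConnected (D : Multigraph m q) : Prop :=
  D.WeaklyConnectedOn Set.univ

/-- `D` is `ℓ`-edge connected: it has at least two vertices, and deleting any set of at
most `ℓ - 1` edges leaves a weakly connected multigraph. -/
def EdgeConnected (D : Multigraph m q) (ℓ : ℕ) : Prop :=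
  2 ≤ m ∧ ∀ F : Finset (Fin q), F.card ≤ ℓ - 1 → D.WeaklyConnectedOn {e | e ∉ F}

/-- `p` is a directed Hamiltonian path of `D` starting at `u`: a directed path that
visits every vertex exactly once. -/
def IsHamiltonianPath (D : Multigraph m q) (u : Fin m) (p : List (Fin q)) : Prop :=
  (∃ v, D.IsPath u v p) ∧ (u :: p.map D.tgt).Nodup ∧
    ∀ w : Fin m, w ∈ u :: p.map D.tgt

/-- `D` contains a directed Hamiltonian path. -/
def HasHamiltonianPath (D : Multigraph m q) : Prop :=
  ∃ u p, D.IsHamiltonianPath u p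

/-- `D` is simple: no two distinct edges have the same unordered pair of endpoints. -/
def Simple (D : Multigraph m q) : Prop :=
  ∀ e e' : Fin q, e ≠ e' →
    ¬ ((D.src e = D.src e' ∧ D.tgt e = D.tgt e') ∨
       (D.src e = D.tgt e' ∧ D.tgt e = D.src e'))

/-- `D` together with designated edges `H i` (from vertex `i` to vertex `i+1`, 0-based)
is a Hamiltonian-path digraph: the designated edges are pairwise distinct, form the
Hamiltonian path, and every edge goes from a smaller vertex to a larger one.
(Vertices `0, …, m-1` here represent the vertices `1, …, m`.) -/
def IsHamPathDigraph (D : Multigraph m q) (H : Fin (m - 1) → Fin q) : Prop :=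
  Function.Injective H ∧
  (∀ i : Fin (m - 1), (D.src (H i)).val = i.val ∧ (D.tgt (H i)).val = i.val + 1) ∧
  ∀ e : Fin q, (D.src e).val < (D.tgt e).val

end Multigraph
namespace Multigraph

variable {m q : ℕ}

/-- `p` is a possibly empty directed walk from `u` to `v`. -/
def IsWalk (D : Multigraph m q) : Fin m → Fin m → List (Fin q) → Prop
  | u, v, [] => u = v
  | u, v, e :: p => D.src e = u ∧ D.IsWalk (D.tgt e) v p

theorem IsWalk.append {D : Multigraph m q} {u v w : Fin m} {p r : List (Fin q)}
    (hp : D.IsWalk u v p) (hr : D.IsWalk v w r) : D.IsWalk u w (p ++ r) := by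
  induction p generalizing u with
  | nil => cases hp; exact hr
  | cons e p ih => exact ⟨hp.1, ih hp.2⟩

theorem IsWalk.isPath {D : Multigraph m q} {u v : Fin m} {p : List (Fin q)}
    (hp : D.IsWalk u v p) (hne : p ≠ []) : D.IsPath u v p := by
  induction p generalizing u with
  | nil => exact absurd rfl hne
  | cons e p ih =>
    obtain ⟨hsrc, hwalk⟩ := hp
    cases p with
    | nil => exact ⟨⟨e, [], rfl, hsrc⟩, ⟨e, [], rfl, hwalk⟩, List.isChain_singleton e⟩
    | cons f p =>
      obtain ⟨-, ⟨g, r, hr, hg⟩, hchain⟩ := ih hwalk (List.cons_ne_nil f p)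
      exact ⟨⟨e, f :: p, rfl, hsrc⟩, ⟨g, e :: r, by rw [hr, List.cons_append], hg⟩,
        List.isChain_cons_cons.2 ⟨hwalk.1.symm, hchain⟩⟩

/-- If every edge increases the vertex label, there are finitely many paths between
two vertices. -/
theorem finite_paths {D : Multigraph m q} (hlt : ∀ e, (D.src e).val < (D.tgt e).val)
    (u v : Fin m) : Finite {p : List (Fin q) // D.IsPath u v p} := by
  have hnodup : ∀ p : List (Fin q), D.IsPath u v p → p.Nodup := fun p hp => by
    have hchain : (p.map D.tgt).IsChain (· < ·) :=
      (List.isChain_map D.tgt).2 <| List.IsChain.imp (fun a b hab => by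
        change (D.tgt a).val < (D.tgt b).val
        rw [hab]
        exact hlt b) hp.2.2
    exact List.Nodup.of_map D.tgt ((List.isChain_iff_pairwise.1 hchain).imp ne_of_lt)
  exact Finite.of_injective
    (fun p : {p : List (Fin q) // D.IsPath u v p} =>
      (⟨p.1, hnodup p.1 p.2⟩ : {l : List (Fin q) // l.Nodup}))
    fun p r hpr => Subtype.ext (Subtype.mk.inj hpr)

/-- In a Hamiltonian-path digraph, the designated edges join any vertex to any later one. -/
theorem IsHamPathDigraph.exists_isWalk {D : Multigraph m q} {H : Fin (m - 1) → Fin q}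
    (hD : D.IsHamPathDigraph H) (a b : ℕ) (hab : a ≤ b) (hb : b < m) :
    ∃ p, D.IsWalk ⟨a, hab.trans_lt hb⟩ ⟨b, hb⟩ p ∧ ∀ e ∈ p, ∃ i, H i = e := by
  induction b, hab using Nat.le_induction with
  | base => exact ⟨[], rfl, by simp⟩
  | succ b hab ih =>
    obtain ⟨p, hp, hpH⟩ := ih (by omega)
    obtain ⟨hs, ht⟩ := hD.2.1 ⟨b, by omega⟩
    refine ⟨p ++ [H ⟨b, by omega⟩], hp.append ⟨Fin.ext hs, Fin.ext ht⟩, fun e he => ?_⟩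
    rcases List.mem_append.1 he with he | he
    · exact hpH e he
    · exact ⟨_, (List.mem_singleton.1 he).symm⟩

/-- Every set of at most one arc is the set of arcs of some source-to-sink path. -/
theorem IsHamPathDigraph.exists_isPath {D : Multigraph m q} {H : Fin (m - 1) → Fin q}
    (hD : D.IsHamPathDigraph H) (hm : 1 < m) (o : Option {e : Fin q // ∀ i, H i ≠ e}) :
    ∃ p, D.IsPath ⟨0, by omega⟩ ⟨m - 1, by omega⟩ p ∧
      ∀ e : {e : Fin q // ∀ i, H i ≠ e}, e.1 ∈ p ↔ o = some e := by
  cases o with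
  | none =>
    obtain ⟨p, hp, hpH⟩ := hD.exists_isWalk 0 (m - 1) (by omega) (by omega)
    refine ⟨p, hp.isPath ?_, fun e => ⟨fun he => ?_, fun h => nomatch h⟩⟩
    · rintro rfl
      have := congrArg Fin.val hp
      simp only at this
      omega
    · obtain ⟨i, hi⟩ := hpH _ he
      exact absurd hi (e.2 i)
  | some f =>
    obtain ⟨p, hp, hpH⟩ := hD.exists_isWalk 0 (D.src f.1) (by omega) (D.src f.1).2
    obtain ⟨r, hr, hrH⟩ := hD.exists_isWalk (D.tgt f.1) (m - 1) (by omega) (by omega)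
    have hwalk : D.IsWalk (D.src f.1) ⟨m - 1, by omega⟩ (f.1 :: r) := ⟨rfl, hr⟩
    refine ⟨p ++ f.1 :: r, (hp.append hwalk).isPath (by simp), fun e => ⟨fun he => ?_, ?_⟩⟩
    · rcases List.mem_append.1 he with he | he
      · obtain ⟨i, hi⟩ := hpH _ he
        exact absurd hi (e.2 i)
      · rcases List.mem_cons.1 he with he | he
        · exact congrArg some (Subtype.ext he.symm)
        · obtain ⟨i, hi⟩ := hrH _ he
          exact absurd hi (e.2 i)
    · rintro ⟨⟩
      simp

end Multigraph

/-- A Hamiltonian-path digraph on `{1, …, m}` (0-based `Fin m`) with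
exactly `k` arcs has at least `k + 1` source-to-sink paths. -/
theorem arcs_lower_bound_paths (m q k : ℕ) (hm : 1 ≤ m) (D : Multigraph m q)
    (H : Fin (m - 1) → Fin q) (hD : D.IsHamPathDigraph H)
    (hk : (Finset.univ.filter (fun e : Fin q => ∀ i, H i ≠ e)).card = k) :
    k + 1 ≤ D.mu ⟨0, by omega⟩ ⟨m - 1, by omega⟩ := by
  obtain rfl | hm' := hm.eq_or_lt
  · have : k = 0 := by
      rw [← hk, Finset.card_eq_zero, Finset.filter_eq_empty_iff]
      intro e
      have := hD.2.2 e
      omega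
    simp [this, Multigraph.mu]
  · have hne : (⟨m - 1, by omega⟩ : Fin m) ≠ ⟨0, by omega⟩ := by
      simp only [ne_eq, Fin.mk.injEq]
      omega
    rw [Multigraph.mu, if_neg hne, Multigraph.pathCount]
    choose P hP hmem using hD.exists_isPath hm'
    have := Multigraph.finite_paths hD.2.2 ⟨0, by omega⟩ ⟨m - 1, by omega⟩
    have hinj : Function.Injective fun o =>
        (⟨P o, hP o⟩ : {p // D.IsPath ⟨0, by omega⟩ ⟨m - 1, by omega⟩ p}) := by
      intro o o' h
      have h' : P o = P o' := congrArg Subtype.val h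
      refine Option.ext fun e => ?_
      rw [← hmem, ← hmem, h']
    have hcard := Nat.card_le_card_of_injective _ hinj
    rwa [Finite.card_option, Nat.card_eq_fintype_card, Fintype.card_subtype, hk] at hcard
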